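/- Let X be a geodesic δ-hyperbolic metric space, λ ≥ 1 (with quasi-geodesic constants 1/λ ≤ (|s −t| error factors) ≤ λ), c ≥ 6λ²δ, and let γ̃ : [a,b] → X satisfy (1/λ)|s−t| − c ≤ |γ̃(s) − γ̃(t)| ≤ λ|s−t| + c for all s,t. Let γ be any geodesic segment with the same endpoints as γ̃. Then for all t ∈ [a,b], d(γ̃(t), im γ) ≤ 12(1 + 8λ²)(δ + c), and for all s in the domain of γ, d(γ(s), im γ̃) ≤ 16(5 + 6λ²)(δ + c). -/

import Mathlib

/-- The Gromov product `(x|y)_o`. -/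
noncomputable def gromovProd {X : Type*} [MetricSpace X] (o x y : X) : ℝ :=
  (dist o x + dist o y - dist x y) / 2

/-- `δ`-hyperbolicity in Gromov's four-point sense. -/
def IsDeltaHyperbolic (X : Type*) [MetricSpace X] (δ : ℝ) : Prop :=
  ∀ x₀ x₁ x₂ x₃ : X,
    min (gromovProd x₀ x₁ x₂) (gromovProd x₀ x₂ x₃) - δ ≤ gromovProd x₀ x₁ x₃

/-- A geodesic metric space. -/
def IsGeodesicSpace (X : Type*) [MetricSpace X] : Prop :=
  ∀ x y : X, ∃ f : ℝ → X, f 0 = x ∧ f (dist x y) = y ∧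
    ∀ s ∈ Set.Icc (0 : ℝ) (dist x y), ∀ t ∈ Set.Icc (0 : ℝ) (dist x y),
      dist (f s) (f t) = |s - t|

/-- The four-point inequality in terms of the three sums of opposite distances. -/
theorem IsDeltaHyperbolic.four_point {X : Type*} [MetricSpace X] {δ : ℝ}
    (h : IsDeltaHyperbolic X δ) (x y z w : X) :
    dist x z + dist y w ≤ dist x w + dist y z + 2 * δ ∨
      dist x z + dist y w ≤ dist x y + dist z w + 2 * δ := by
  have h4 := h x y z w
  simp only [gromovProd] at h4
  rcases min_cases ((dist x y + dist x z - dist y z) / 2)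
    ((dist x z + dist x w - dist z w) / 2) with ⟨hm, -⟩ | ⟨hm, -⟩
  · left
    rw [hm] at h4
    linarith
  · right
    rw [hm] at h4
    linarith

/-- Every point has a nearest point on a geodesic segment. -/
theorem exists_nearest_on_geodesic {X : Type*} [MetricSpace X] {L : ℝ} (hL : 0 ≤ L) {γ : ℝ → X}
    (hγ : ∀ s ∈ Set.Icc (0 : ℝ) L, ∀ t ∈ Set.Icc (0 : ℝ) L, dist (γ s) (γ t) = |s - t|) (x : X) :
    ∃ u ∈ Set.Icc (0 : ℝ) L, ∀ v ∈ Set.Icc (0 : ℝ) L, dist x (γ u) ≤ dist x (γ v) := by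
  have hcont : ContinuousOn γ (Set.Icc 0 L) := by
    refine LipschitzOnWith.continuousOn (K := 1) (LipschitzOnWith.of_dist_le_mul ?_)
    intro s hs t ht
    rw [hγ s hs t ht, Real.dist_eq]
    simp
  have hdist : ContinuousOn (fun u => dist x (γ u)) (Set.Icc 0 L) := by fun_prop
  exact isCompact_Icc.exists_isMinOn ⟨0, le_rfl, hL⟩ hdist

/-- Going from `x` to a point of a geodesic through the nearest point is optimal up to `4δ`. -/
theorem IsDeltaHyperbolic.dist_add_le_of_nearest {X : Type*} [MetricSpace X] {δ : ℝ} (hδ : 0 ≤ δ)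
    (h : IsDeltaHyperbolic X δ) {L : ℝ} {γ : ℝ → X}
    (hγ : ∀ s ∈ Set.Icc (0 : ℝ) L, ∀ t ∈ Set.Icc (0 : ℝ) L, dist (γ s) (γ t) = |s - t|)
    {x : X} {u v : ℝ} (hu : u ∈ Set.Icc (0 : ℝ) L)
    (hmin : ∀ v ∈ Set.Icc (0 : ℝ) L, dist x (γ u) ≤ dist x (γ v)) (hv : v ∈ Set.Icc (0 : ℝ) L) :
    dist x (γ u) + |u - v| ≤ dist x (γ v) + 4 * δ := by
  by_contra! hlt
  obtain ⟨r, hr⟩ : ∃ r, r = (dist x (γ u) + |u - v| - dist x (γ v)) / 2 := ⟨_, rfl⟩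
  have hrpos : 2 * δ < r := by linarith
  have hrle : r ≤ |u - v| := by linarith [hmin v hv, abs_nonneg (u - v)]
  obtain ⟨w, hw, huw, hvw⟩ : ∃ w ∈ Set.Icc (0 : ℝ) L, |u - w| = r ∧ |v - w| = |u - v| - r := by
    rcases le_total u v with huv | huv
    · rw [abs_of_nonpos (by linarith)] at hrle
      refine ⟨u + r, ⟨by linarith [hu.1], by linarith [hv.2]⟩, ?_, ?_⟩
      · rw [abs_of_nonpos (by linarith)]
        ring
      · rw [abs_of_nonneg (by linarith), abs_of_nonpos (by linarith)]
        ring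
    · rw [abs_of_nonneg (by linarith)] at hrle
      refine ⟨u - r, ⟨by linarith [hv.1], by linarith [hu.2]⟩, ?_, ?_⟩
      · rw [abs_of_nonneg (by linarith)]
        ring
      · rw [abs_of_nonpos (by linarith), abs_of_nonneg (by linarith)]
        ring
  have hxw := hmin w hw
  have h4 := h.four_point (γ u) x (γ v) (γ w)
  rw [hγ u hu v hv, hγ u hu w hw, hγ v hv w hw, huw, hvw, dist_comm (γ u) x] at h4
  rcases h4 with h4 | h4 <;> linarith

/-- Nearest-point projection to a geodesic collapses pairs of points far from the geodesic,
relative to their mutual distance, to size `5δ`. -/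
theorem IsDeltaHyperbolic.abs_sub_le_of_nearest {X : Type*} [MetricSpace X] {δ : ℝ} (hδ : 0 ≤ δ)
    (h : IsDeltaHyperbolic X δ) {L : ℝ} {γ : ℝ → X}
    (hγ : ∀ s ∈ Set.Icc (0 : ℝ) L, ∀ t ∈ Set.Icc (0 : ℝ) L, dist (γ s) (γ t) = |s - t|)
    {x y : X} {u v : ℝ} (hu : u ∈ Set.Icc (0 : ℝ) L)
    (humin : ∀ v ∈ Set.Icc (0 : ℝ) L, dist x (γ u) ≤ dist x (γ v)) (hv : v ∈ Set.Icc (0 : ℝ) L)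
    (hvmin : ∀ u ∈ Set.Icc (0 : ℝ) L, dist y (γ v) ≤ dist y (γ u))
    (hfar : dist x y + 3 * δ ≤ dist x (γ u)) : |u - v| ≤ 5 * δ := by
  have h1 := h.dist_add_le_of_nearest hδ hγ hu humin hv
  have h2 := h.dist_add_le_of_nearest hδ hγ hv hvmin hu
  rw [abs_sub_comm] at h2
  have h3 : dist x (γ u) ≤ dist x y + dist y (γ v) :=
    (humin v hv).trans (dist_triangle _ _ _)
  have h4 := h.four_point x y (γ v) (γ u)
  rw [hγ v hv u hu, abs_sub_comm v u] at h4
  rcases h4 with h4 | h4 <;> linarith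

/-- Walking backwards from `t` in steps of size `T` until `P` holds, a function `g` varying by at
most `κ` per step outside `P` varies by at most `κ` times the number of steps. -/
theorem exists_backward_of_step {a b T κ : ℝ} (hT : 0 < T) (hκ : 0 ≤ κ) {P : ℝ → Prop} {g : ℝ → ℝ}
    (hstep : ∀ s ∈ Set.Icc a b, ∀ t ∈ Set.Icc a b, |s - t| ≤ T → ¬ P s → |g s - g t| ≤ κ)
    (ha : P a) {t : ℝ} (ht : t ∈ Set.Icc a b) :
    ∃ s ∈ Set.Icc a t, P s ∧ |g t - g s| ≤ κ * ((t - s) / T + 1) := by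
  obtain ⟨n, hn⟩ := exists_nat_ge ((t - a) / T)
  rw [div_le_iff₀ hT] at hn
  induction n generalizing t with
  | zero =>
    have hta : t = a := le_antisymm (by simpa using hn) ht.1
    subst hta
    exact ⟨t, ⟨le_rfl, le_rfl⟩, ha, by simpa using hκ⟩
  | succ n ih =>
    by_cases hP : P t
    · exact ⟨t, ⟨ht.1, le_rfl⟩, hP, by simpa using hκ⟩
    rcases le_total (t - T) a with hle | hle
    · refine ⟨a, ⟨le_rfl, ht.1⟩, ha, ?_⟩
      have hd : 0 ≤ (t - a) / T := div_nonneg (by linarith [ht.1]) hT.le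
      have hs := hstep t ht a ⟨le_rfl, ht.1.trans ht.2⟩
        (by rw [abs_of_nonneg (by linarith [ht.1])]; linarith) hP
      nlinarith
    · have hmem : t - T ∈ Set.Icc a b := ⟨hle, by linarith [ht.2]⟩
      push_cast at hn
      obtain ⟨s, hs, hPs, hgs⟩ := ih hmem (by linarith)
      refine ⟨s, ⟨hs.1, by linarith [hs.2]⟩, hPs, ?_⟩
      have h1 := hstep t ht (t - T) hmem (by rw [sub_sub_cancel, abs_of_pos hT]) hP
      have h2 : (t - T - s) / T = (t - s) / T - 1 := by
        field_simp
        ring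
      rw [h2] at hgs
      have h3 := abs_sub_le (g t) (g (t - T)) (g s)
      linarith

/-- The forward version of `exists_backward_of_step`. -/
theorem exists_forward_of_step {a b T κ : ℝ} (hT : 0 < T) (hκ : 0 ≤ κ) {P : ℝ → Prop} {g : ℝ → ℝ}
    (hstep : ∀ s ∈ Set.Icc a b, ∀ t ∈ Set.Icc a b, |s - t| ≤ T → ¬ P s → |g s - g t| ≤ κ)
    (hb : P b) {t : ℝ} (ht : t ∈ Set.Icc a b) :
    ∃ s ∈ Set.Icc t b, P s ∧ |g t - g s| ≤ κ * ((s - t) / T + 1) := by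
  obtain ⟨s, hs, hPs, hgs⟩ := exists_backward_of_step (a := -b) (b := -a) (t := -t) hT hκ
    (P := fun s => P (-s)) (g := fun s => g (-s))
    (fun s hs t ht hst hP => hstep (-s) ⟨by linarith [hs.2], by linarith [hs.1]⟩
      (-t) ⟨by linarith [ht.2], by linarith [ht.1]⟩
      (by rwa [neg_sub_neg, abs_sub_comm]) hP)
    (by simpa using hb) ⟨by linarith [ht.2], by linarith [ht.1]⟩
  refine ⟨-s, ⟨by linarith [hs.2], by linarith [hs.1]⟩, hPs, ?_⟩
  simpa [sub_eq_add_neg, add_comm] using hgs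

/-- A discrete intermediate value property: a real function crosses any intermediate level within
a pair of points at distance at most `T`. -/
theorem exists_crossing_step {a b T : ℝ} (hT : 0 < T) (hab : a ≤ b) {g : ℝ → ℝ} {y : ℝ}
    (ha : g a ≤ y) (hb : y ≤ g b) :
    ∃ s ∈ Set.Icc a b, ∃ t ∈ Set.Icc a b, |s - t| ≤ T ∧ g s ≤ y ∧ y ≤ g t := by
  obtain ⟨n, hn⟩ := exists_nat_ge ((b - a) / T)
  rw [div_le_iff₀ hT] at hn
  induction n generalizing a with
  | zero =>
    have hba : b = a := le_antisymm (by simpa using hn) hab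
    subst hba
    exact ⟨b, ⟨le_rfl, le_rfl⟩, b, ⟨le_rfl, le_rfl⟩, by simpa using hT.le, ha, hb⟩
  | succ n ih =>
    push_cast at hn
    rcases le_total b (a + T) with hle | hle
    · refine ⟨a, ⟨le_rfl, hab⟩, b, ⟨hab, le_rfl⟩, ?_, ha, hb⟩
      rw [abs_of_nonpos (by linarith)]
      linarith
    rcases le_total (g (a + T)) y with hg | hg
    · obtain ⟨s, hs, t, ht, hst⟩ := ih hle hg (by linarith)
      exact ⟨s, ⟨by linarith [hs.1], hs.2⟩, t, ⟨by linarith [ht.1], ht.2⟩, hst⟩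
    · refine ⟨a, ⟨le_rfl, hab⟩, a + T, ⟨by linarith, hle⟩, ?_, ha, hg⟩
      rw [sub_add_cancel_left, abs_neg, abs_of_pos hT]

/-- Stability of quasigeodesics with positive additive constant, phrased through a choice `τ` of
nearest-point parameters. -/
theorem IsDeltaHyperbolic.dist_nearest_le_of_quasigeodesic {X : Type*} [MetricSpace X] {δ : ℝ}
    (hδ : 0 ≤ δ) (hhyp : IsDeltaHyperbolic X δ) {lam : ℝ} (hlam : 1 ≤ lam) {c : ℝ} (hc₀ : 0 < c)
    (hc : 6 * lam ^ 2 * δ ≤ c) {a b : ℝ} {γ' : ℝ → X}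
    (hquasi : ∀ s ∈ Set.Icc a b, ∀ t ∈ Set.Icc a b,
      (1 / lam) * |s - t| - c ≤ dist (γ' s) (γ' t) ∧
        dist (γ' s) (γ' t) ≤ lam * |s - t| + c)
    {L : ℝ} {γ : ℝ → X}
    (hγ : ∀ s ∈ Set.Icc (0 : ℝ) L, ∀ t ∈ Set.Icc (0 : ℝ) L, dist (γ s) (γ t) = |s - t|)
    {τ : ℝ → ℝ} (hτ : ∀ t, τ t ∈ Set.Icc (0 : ℝ) L)
    (hmin : ∀ t, ∀ v ∈ Set.Icc (0 : ℝ) L, dist (γ' t) (γ (τ t)) ≤ dist (γ' t) (γ v))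
    (ha : dist (γ' a) (γ (τ a)) = 0) (hb : dist (γ' b) (γ (τ b)) = 0)
    {t : ℝ} (ht : t ∈ Set.Icc a b) :
    dist (γ' t) (γ (τ t)) ≤ 4 * c + 3 * δ + lam ^ 2 * (12 * c + 28 * δ) := by
  have hlam₀ : 0 < lam := by linarith
  obtain ⟨T, hTdef⟩ : ∃ T, T = 2 * c / lam := ⟨_, rfl⟩
  have hT : 0 < T := by
    rw [hTdef]
    positivity
  have hlamT : lam * T = 2 * c := by
    rw [hTdef]
    field_simp
  have hstep : ∀ s ∈ Set.Icc a b, ∀ t ∈ Set.Icc a b, |s - t| ≤ T →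
      ¬ dist (γ' s) (γ (τ s)) ≤ 3 * c + 3 * δ → |τ s - τ t| ≤ 5 * δ := by
    intro s hs t ht hst hfar
    refine hhyp.abs_sub_le_of_nearest hδ hγ (hτ s) (hmin s) (hτ t) (hmin t) ?_
    have h1 := (hquasi s hs t ht).2
    have h2 := mul_le_mul_of_nonneg_left hst hlam₀.le
    linarith
  obtain ⟨p, hp, hpP, hpg⟩ := exists_backward_of_step
    (P := fun s => dist (γ' s) (γ (τ s)) ≤ 3 * c + 3 * δ) hT (by positivity : 0 ≤ 5 * δ) hstep
    (by rw [ha]; positivity) ht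
  obtain ⟨q, hq, hqP, hqg⟩ := exists_forward_of_step
    (P := fun s => dist (γ' s) (γ (τ s)) ≤ 3 * c + 3 * δ) hT (by positivity : 0 ≤ 5 * δ) hstep
    (by rw [hb]; positivity) ht
  have hpab : p ∈ Set.Icc a b := ⟨hp.1, hp.2.trans ht.2⟩
  have hqab : q ∈ Set.Icc a b := ⟨ht.1.trans hq.1, hq.2⟩
  obtain ⟨ℓ, hℓ⟩ : ∃ ℓ, ℓ = (q - p) / lam := ⟨_, rfl⟩
  have hℓ₀ : 0 ≤ ℓ := by
    rw [hℓ]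
    exact div_nonneg (by linarith [hp.2, hq.1]) hlam₀.le
  have hqp : q - p = lam * ℓ := by
    rw [hℓ]
    field_simp
  have hproj : |τ p - τ q| ≤ 10 * δ + 5 / 12 * ℓ := by
    have h1 := abs_sub_le (τ p) (τ t) (τ q)
    rw [abs_sub_comm (τ p) (τ t)] at h1
    have h2 : 5 * δ * ((t - p) / T + 1) + 5 * δ * ((q - t) / T + 1)
        = 10 * δ + 5 * δ * ((q - p) / T) := by
      field_simp
      ring
    have h3 : δ * ((q - p) / T) ≤ ℓ / 12 := by
      rw [hqp, mul_div_assoc', div_le_iff₀ hT]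
      have h4 : 12 * (lam * δ) ≤ T := by
        rw [hTdef, le_div_iff₀ hlam₀]
        linarith
      nlinarith
    linarith
  have hlower := (hquasi p hpab q hqab).1
  have hℓabs : 1 / lam * |p - q| = ℓ := by
    rw [abs_of_nonpos (by linarith [hp.2, hq.1]), hℓ]
    ring
  rw [hℓabs] at hlower
  have hpq : dist (γ' p) (γ' q) ≤ dist (γ' p) (γ (τ p)) + |τ p - τ q| + dist (γ' q) (γ (τ q)) := by
    have := dist_triangle4 (γ' p) (γ (τ p)) (γ (τ q)) (γ' q)
    rwa [hγ _ (hτ p) _ (hτ q), dist_comm (γ (τ q))] at this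
  have hℓle : ℓ ≤ 12 * c + 28 * δ := by linarith
  have hupper := (hquasi t ht p hpab).2
  rw [abs_of_nonneg (by linarith [hp.2])] at hupper
  have htp : lam * (t - p) ≤ lam ^ 2 * (12 * c + 28 * δ) := by
    calc lam * (t - p) ≤ lam * (q - p) := by
          gcongr
          exact hq.1
      _ = lam ^ 2 * ℓ := by
          rw [hqp]
          ring
      _ ≤ _ := by gcongr
  have h1 := hmin t _ (hτ p)
  have h2 := dist_triangle (γ' t) (γ' p) (γ (τ p))
  linarith

/-- Quantitative Morse stability for quasigeodesics: a `(1/λ, λ, c)`-quasigeodesic segment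
with `c ≥ 6λ²δ` stays within `12(1+8λ²)(δ+c)` of any geodesic with the same endpoints, and the
geodesic stays within `16(5+6λ²)(δ+c)` of the quasigeodesic. -/
theorem quantitative_morse_stability
    (X : Type*) [MetricSpace X] (δ : ℝ) (hδ : 0 ≤ δ)
    (hgeo : IsGeodesicSpace X) (hhyp : IsDeltaHyperbolic X δ)
    (lam : ℝ) (hlam : 1 ≤ lam) (c : ℝ) (hc : 6 * lam ^ 2 * δ ≤ c)
    (a b : ℝ) (hab : a ≤ b)
    (γ' : ℝ → X)
    (hquasi : ∀ s ∈ Set.Icc a b, ∀ t ∈ Set.Icc a b,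
      (1 / lam) * |s - t| - c ≤ dist (γ' s) (γ' t) ∧
        dist (γ' s) (γ' t) ≤ lam * |s - t| + c)
    (γ : ℝ → X) (hγ0 : γ 0 = γ' a) (hγL : γ (dist (γ' a) (γ' b)) = γ' b)
    (hγ : ∀ s ∈ Set.Icc (0 : ℝ) (dist (γ' a) (γ' b)),
      ∀ t ∈ Set.Icc (0 : ℝ) (dist (γ' a) (γ' b)), dist (γ s) (γ t) = |s - t|) :
    (∀ t ∈ Set.Icc a b,
      Metric.infDist (γ' t) (γ '' Set.Icc (0 : ℝ) (dist (γ' a) (γ' b))) ≤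
        12 * (1 + 8 * lam ^ 2) * (δ + c)) ∧
    (∀ s ∈ Set.Icc (0 : ℝ) (dist (γ' a) (γ' b)),
      Metric.infDist (γ s) (γ' '' Set.Icc a b) ≤ 16 * (5 + 6 * lam ^ 2) * (δ + c)) := by
  have hL : 0 ≤ dist (γ' a) (γ' b) := dist_nonneg
  have hδlam : 0 ≤ lam ^ 2 * δ := by positivity
  have hc₀ : 0 ≤ c := by linarith
  have h0I : (0 : ℝ) ∈ Set.Icc 0 (dist (γ' a) (γ' b)) := ⟨le_rfl, hL⟩
  have hLI : dist (γ' a) (γ' b) ∈ Set.Icc 0 (dist (γ' a) (γ' b)) := ⟨hL, le_rfl⟩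
  choose τ hτ hmin using fun t => exists_nearest_on_geodesic hL hγ (γ' t)
  have ha : dist (γ' a) (γ (τ a)) = 0 :=
    le_antisymm (by simpa [hγ0] using hmin a 0 h0I) dist_nonneg
  have hb : dist (γ' b) (γ (τ b)) = 0 :=
    le_antisymm (by simpa [hγL] using hmin b _ hLI) dist_nonneg
  have hτa : τ a = 0 := by
    have h1 := hγ 0 h0I _ (hτ a)
    rw [hγ0, ha] at h1
    linarith [abs_eq_zero.mp h1.symm]
  have hτb : τ b = dist (γ' a) (γ' b) := by
    have h1 := hγ _ hLI _ (hτ b)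
    rw [hγL, hb] at h1
    linarith [abs_eq_zero.mp h1.symm]
  have hquasi' : ∀ e, c < e → ∀ s ∈ Set.Icc a b, ∀ t ∈ Set.Icc a b,
      (1 / lam) * |s - t| - e ≤ dist (γ' s) (γ' t) ∧
        dist (γ' s) (γ' t) ≤ lam * |s - t| + e := by
    intro e he s hs t ht
    have h1 := hquasi s hs t ht
    exact ⟨by linarith [h1.1], by linarith [h1.2]⟩
  have hbound : ∀ e, c < e → ∀ t ∈ Set.Icc a b,
      dist (γ' t) (γ (τ t)) ≤ 4 * e + 3 * δ + lam ^ 2 * (12 * e + 28 * δ) :=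
    fun e he t ht => hhyp.dist_nearest_le_of_quasigeodesic hδ hlam (by linarith) (by linarith)
      (hquasi' e he) hγ hτ hmin ha hb ht
  have hlim : ∀ {x K : ℝ}, (∀ e, c < e → x ≤ K * (δ + e)) → x ≤ K * (δ + c) := by
    intro x K hx
    have hcont : Filter.Tendsto (fun e => K * (δ + e)) (nhdsWithin c (Set.Ioi c))
        (nhds (K * (δ + c))) :=
      (Continuous.tendsto (by fun_prop) c).mono_left nhdsWithin_le_nhds
    exact ge_of_tendsto hcont (Filter.eventually_of_mem self_mem_nhdsWithin hx)
  constructor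
  · intro t ht
    refine hlim fun e he => ?_
    refine (Metric.infDist_le_dist_of_mem (Set.mem_image_of_mem γ (hτ t))).trans ?_
    have he₀ : 0 ≤ e := by linarith
    have h1 : 0 ≤ lam ^ 2 * e := by positivity
    nlinarith [hbound e he t ht]
  · intro s hs
    refine hlim fun e he => ?_
    have he₀ : 0 < e := by linarith
    have hlam₀ : 0 < lam := by linarith
    obtain ⟨p, hp, q, hq, hpq, hps, hsq⟩ := exists_crossing_step (T := e / lam) (by positivity) hab
      (g := τ) (y := s) (by rw [hτa]; exact hs.1) (by rw [hτb]; exact hs.2)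
    refine (Metric.infDist_le_dist_of_mem (Set.mem_image_of_mem γ' hq)).trans ?_
    have hjump : dist (γ' p) (γ' q) ≤ 2 * e := by
      have h1 := (hquasi' e he p hp q hq).2
      rw [le_div_iff₀ hlam₀] at hpq
      linarith
    have hgap : τ q - τ p ≤
        dist (γ' p) (γ (τ p)) + dist (γ' p) (γ' q) + dist (γ' q) (γ (τ q)) := by
      have h1 := dist_triangle4 (γ (τ p)) (γ' p) (γ' q) (γ (τ q))
      rw [hγ _ (hτ p) _ (hτ q), dist_comm (γ (τ p))] at h1
      linarith [neg_abs_le (τ p - τ q)]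
    have hsdist : dist (γ s) (γ' q) ≤ τ q - s + dist (γ' q) (γ (τ q)) := by
      have h1 := dist_triangle (γ s) (γ (τ q)) (γ' q)
      rwa [hγ s hs _ (hτ q), abs_of_nonpos (by linarith), neg_sub, dist_comm (γ (τ q))] at h1
    have h1 : 0 ≤ lam ^ 2 * e := by positivity
    nlinarith [hbound e he p hp, hbound e he q hq]
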